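/- Consider the partial 4 × 4 grid G over ℂ⁴ with rows (e₃, ·, e₁, e₄), (·, e₄, e₃, e₂), (e₁, e₂, e₄, e₃), (e₄, e₃, e₂, e₁), where the two empty cells at positions (1,2) and (2,1) are to be filled with unit vectors x and y respectively. Then for every choice of unit vectors x, y ∈ ℂ⁴, the SudoQ error of the resulting full square is at least 1. In particular the quantum SudoQ score of G satisfies 𝓔_q(G) ≥ 1. -/

import Mathlib

/-- The rank-one projection `|v⟩⟨v|` as a matrix. -/
noncomputable def proj {κ : Type*} [Fintype κ] (v : EuclideanSpace ℂ κ) : Matrix κ κ ℂ :=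
  fun i j => v i * star (v j)

/-- The Frobenius norm `‖A‖₂ = √(Tr(A* A))`. -/
noncomputable def frobNorm {κ : Type*} [Fintype κ] (A : Matrix κ κ ℂ) : ℝ :=
  Real.sqrt (Matrix.trace (A.conjTranspose * A)).re

/-- The standard basis of `ℂ⁴`. -/
noncomputable def E (k : Fin 4) : EuclideanSpace ℂ (Fin 4) :=
  EuclideanSpace.single k 1

/-- The partial grid `G` with rows `(e₃, ·, e₁, e₄)`, `(·, e₄, e₃, e₂)`,
`(e₁, e₂, e₄, e₃)`, `(e₄, e₃, e₂, e₁)`, completed by placing the unit vector `x`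
at position `(1,2)` and `y` at position `(2,1)` (1-indexed). -/
noncomputable def Gsq (x y : EuclideanSpace ℂ (Fin 4)) :
    Fin 4 → Fin 4 → EuclideanSpace ℂ (Fin 4) :=
  ![![E 2, x, E 0, E 3],
    ![y, E 3, E 2, E 1],
    ![E 0, E 1, E 3, E 2],
    ![E 3, E 2, E 1, E 0]]

/-- The twelve SudoQ constraints of a `4 × 4` grid: four rows, four columns, and
four `2 × 2` blocks, each given as the list of its four cells. -/
def constraints : Fin 12 → Fin 4 → Fin 4 × Fin 4 :=
  ![fun j => (0, j), fun j => (1, j), fun j => (2, j), fun j => (3, j),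
    fun i => (i, 0), fun i => (i, 1), fun i => (i, 2), fun i => (i, 3),
    ![(0, 0), (0, 1), (1, 0), (1, 1)], ![(0, 2), (0, 3), (1, 2), (1, 3)],
    ![(2, 0), (2, 1), (3, 0), (3, 1)], ![(2, 2), (2, 3), (3, 2), (3, 3)]]

/-- The deviation of the square `M` from constraint `c`:
`‖ Σ_{cells in c} |v⟩⟨v| − I₄ ‖₂`. -/
noncomputable def dev (M : Fin 4 → Fin 4 → EuclideanSpace ℂ (Fin 4)) (c : Fin 12) : ℝ :=
  frobNorm ((∑ t : Fin 4, proj (M (constraints c t).1 (constraints c t).2)) - 1)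

/-- The SudoQ error of a full square: the maximum deviation over the twelve
constraints. -/
noncomputable def sudoqError (M : Fin 4 → Fin 4 → EuclideanSpace ℂ (Fin 4)) : ℝ :=
  Finset.univ.sup' Finset.univ_nonempty (dev M)

lemma conjTranspose_proj {κ : Type*} [Fintype κ] (v : EuclideanSpace ℂ κ) :
    (proj v).conjTranspose = proj v := by
  ext i j
  simp [proj, Matrix.conjTranspose_apply, mul_comm]

lemma trace_proj_mul_proj {κ : Type*} [Fintype κ] (v w : EuclideanSpace ℂ κ) :
    (proj v * proj w).trace = ((‖inner ℂ v w‖ ^ 2 : ℝ) : ℂ) := by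
  have h : inner ℂ w v = ∑ i, v i * star (w i) := by
    simp [PiLp.inner_apply]
  have h' : inner ℂ v w = ∑ i, w i * star (v i) := by
    simp [PiLp.inner_apply]
  push_cast
  rw [← Complex.mul_conj', inner_conj_symm, h, h', mul_comm, Finset.sum_mul_sum]
  simp only [Matrix.trace, Matrix.diag_apply, Matrix.mul_apply, proj]
  exact Finset.sum_congr rfl fun i _ => Finset.sum_congr rfl fun j _ => by ring

/-- The squared Frobenius distance between two rank-one projections is `2 - 2 |⟨v, w⟩|²`. -/
lemma frobNorm_proj_sub_proj {κ : Type*} [Fintype κ] {v w : EuclideanSpace ℂ κ}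
    (hv : ‖v‖ = 1) (hw : ‖w‖ = 1) :
    frobNorm (proj v - proj w) = Real.sqrt (2 - 2 * ‖inner ℂ v w‖ ^ 2) := by
  rw [frobNorm, Matrix.conjTranspose_sub, conjTranspose_proj, conjTranspose_proj]
  congr 1
  simp only [sub_mul, mul_sub, Matrix.trace_sub, trace_proj_mul_proj, Complex.sub_re,
    Complex.ofReal_re, norm_inner_symm w v, inner_self_eq_norm_sq_to_K, hv, hw]
  norm_num
  ring

lemma norm_E (k : Fin 4) : ‖E k‖ = 1 := by
  simp [E]

/-- If `|x_k|² ≤ 1/2`, then the projection on `x` is at distance at least `1` from that on `e_k`. -/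
lemma one_le_frobNorm_proj_sub_proj_E {x : EuclideanSpace ℂ (Fin 4)} (hx : ‖x‖ = 1) {k : Fin 4}
    (hk : ‖x k‖ ^ 2 ≤ 1 / 2) : 1 ≤ frobNorm (proj x - proj (E k)) := by
  have h : ‖inner ℂ x (E k)‖ = ‖x k‖ := by
    simp [E, EuclideanSpace.inner_single_right]
  rw [frobNorm_proj_sub_proj hx (norm_E k), h, Real.one_le_sqrt]
  linarith

lemma sum_proj_E : ∑ k, proj (E k) = 1 := by
  ext i j
  simp [Matrix.sum_apply, proj, E, Matrix.one_apply]

lemma dev_Gsq_row (x y : EuclideanSpace ℂ (Fin 4)) :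
    dev (Gsq x y) 0 = frobNorm (proj x - proj (E 1)) := by
  rw [dev, ← sum_proj_E, Fin.sum_univ_four, Fin.sum_univ_four]
  change frobNorm (proj (E 2) + proj x + proj (E 0) + proj (E 3) - _) = _
  congr 1
  abel

lemma dev_Gsq_column (x y : EuclideanSpace ℂ (Fin 4)) :
    dev (Gsq x y) 5 = frobNorm (proj x - proj (E 0)) := by
  rw [dev, ← sum_proj_E, Fin.sum_univ_four, Fin.sum_univ_four]
  change frobNorm (proj x + proj (E 3) + proj (E 1) + proj (E 2) - _) = _
  congr 1
  abel

lemma one_le_sudoqError_Gsq {x : EuclideanSpace ℂ (Fin 4)} (hx : ‖x‖ = 1)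
    (y : EuclideanSpace ℂ (Fin 4)) : 1 ≤ sudoqError (Gsq x y) := by
  have hsum : ‖x 0‖ ^ 2 + ‖x 1‖ ^ 2 + ‖x 2‖ ^ 2 + ‖x 3‖ ^ 2 = 1 := by
    rw [← Fin.sum_univ_four fun i => ‖x i‖ ^ 2, ← EuclideanSpace.norm_sq_eq, hx, one_pow]
  have hle (c : Fin 12) : dev (Gsq x y) c ≤ sudoqError (Gsq x y) :=
    Finset.le_sup' (dev (Gsq x y)) (Finset.mem_univ c)
  rcases le_or_gt (‖x 1‖ ^ 2) (1 / 2) with h | h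
  · exact (one_le_frobNorm_proj_sub_proj_E hx h).trans (dev_Gsq_row x y ▸ hle 0)
  · have h0 : ‖x 0‖ ^ 2 ≤ 1 / 2 := by
      linarith [sq_nonneg ‖x 2‖, sq_nonneg ‖x 3‖]
    exact (one_le_frobNorm_proj_sub_proj_E hx h0).trans (dev_Gsq_column x y ▸ hle 5)

/-- For every filling of the two empty cells of `G` by unit vectors `x, y`, the
SudoQ error of the resulting full square is at least 1; in particular the quantum
SudoQ score of `G` satisfies `𝓔_q(G) ≥ 1`. -/
theorem sudoq_score_ge_one :
    (∀ x y : EuclideanSpace ℂ (Fin 4), ‖x‖ = 1 → ‖y‖ = 1 → 1 ≤ sudoqError (Gsq x y)) ∧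
    1 ≤ sInf {r : ℝ | ∃ x y : EuclideanSpace ℂ (Fin 4),
      ‖x‖ = 1 ∧ ‖y‖ = 1 ∧ r = sudoqError (Gsq x y)} := by
  refine ⟨fun x y hx _ => one_le_sudoqError_Gsq hx y,
    le_csInf ⟨_, E 0, E 0, norm_E 0, norm_E 0, rfl⟩ ?_⟩
  rintro r ⟨x, y, hx, _, rfl⟩
  exact one_le_sudoqError_Gsq hx y
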